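/- Define the polynomial g(x,y) = -29673216*x^4 + 19035648*y^4 + 95178240*x^2*y^2 - 1916928*y^6 - 14376960*y^4*x^2 - 21012480*y^2*x^4 + 7372800*x^6 + 65536*y^8 + 2162688*y^4*x^4 + 655360*y^6*x^2 + 2621440*x^6*y^2 + 1048576*x^8 - 79361856*y^2 + 119574225 - 198404640*x^2. Then the set of real points (x,y) with g(x,y) = 0, ∂g/∂x(x,y) = 0 and ∂g/∂y(x,y) = 0 is exactly the two-element set {(0, 9/4), (0, -9/4)}. -/

import Mathlib

/-- The polynomial defining the parallel lines at offset r = 3/4 to the ellipse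
y^2/9 + x^2/(9/4) = 1. -/
noncomputable def g16 (x y : ℝ) : ℝ :=
  -29673216*x^4 + 19035648*y^4 + 95178240*x^2*y^2 - 1916928*y^6 - 14376960*y^4*x^2 -
    21012480*y^2*x^4 + 7372800*x^6 + 65536*y^8 + 2162688*y^4*x^4 + 655360*y^6*x^2 +
    2621440*x^6*y^2 + 1048576*x^8 - 79361856*y^2 + 119574225 - 198404640*x^2

/-- `g16` as a polynomial in `U = (4x)^2`, `V = (4y)^2`. -/
noncomputable def gUV (U V : ℝ) : ℝ :=
  (-115911)*U^2*V^0 + (74358)*U^0*V^2 + (371790)*U^1*V^1 + (-468)*U^0*V^3 + (-3510)*U^1*V^2 + (-5130)*U^2*V^1 + (1800)*U^3*V^0 + (1)*U^0*V^4 + (33)*U^2*V^2 + (10)*U^1*V^3 + (40)*U^3*V^1 + (16)*U^4*V^0 + (-4960116)*U^0*V^1 + (119574225)*U^0*V^0 + (-12400290)*U^1*V^0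

/-- partial derivative in `U` -/
noncomputable def gU (U V : ℝ) : ℝ :=
  (-231822)*U^1*V^0 + (371790)*U^0*V^1 + (-3510)*U^0*V^2 + (-10260)*U^1*V^1 + (5400)*U^2*V^0 + (66)*U^1*V^2 + (10)*U^0*V^3 + (120)*U^2*V^1 + (64)*U^3*V^0 + (-12400290)*U^0*V^0

/-- partial derivative in `V` -/
noncomputable def gV (U V : ℝ) : ℝ :=
  (148716)*U^0*V^1 + (371790)*U^1*V^0 + (-1404)*U^0*V^2 + (-7020)*U^1*V^1 + (-5130)*U^2*V^0 + (4)*U^0*V^3 + (66)*U^2*V^1 + (30)*U^1*V^2 + (40)*U^3*V^0 + (-4960116)*U^0*V^0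

/-- Certificate that `U (U^2+3888)^2` lies in the ideal of singular points. -/
theorem cert (U V : ℝ) (h : gUV U V = 0) (hu : gU U V = 0) (hv : gV U V = 0) :
    U * (U^2 + 3888)^2 = 0 := by
  unfold gUV at h
  unfold gU at hu
  unfold gV at hv
  linear_combination (1/746496) * (((-23116590)*U^0*V^0 + (107190)*U^0*V^1 + (101952)*U^1*V^0 + (80)*U^0*V^2 + (528)*U^1*V^1 + (640)*U^2*V^0) * h
    + ((-404595)*U^0*V^0 + (-318978)*U^0*V^1 + (9153405)*U^1*V^0 + (1917)*U^0*V^2 + (-25785)*U^1*V^1 + (-18324)*U^2*V^0 + (-8)*U^0*V^3 + (-80)*U^1*V^2 + (-232)*U^2*V^1 + (-160)*U^3*V^0) * hu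
    + ((-556263450)*U^0*V^0 + (9789660)*U^0*V^1 + (-6585624)*U^1*V^0 + (-29250)*U^0*V^2) * hv)

theorem g16_eq (x y : ℝ) : g16 x y = gUV (16*x^2) (16*y^2) := by
  unfold g16 gUV; ring

theorem deriv_x (x y : ℝ) :
    deriv (fun t : ℝ => g16 t y) x = 32 * x * gU (16*x^2) (16*y^2) := by
  have e : (fun t : ℝ => g16 t y) = fun t : ℝ =>
      1048576*t^8 + (7372800 + 2621440*y^2)*t^6
      + (-29673216 - 21012480*y^2 + 2162688*y^4)*t^4
      + (95178240*y^2 - 14376960*y^4 + 655360*y^6 - 198404640)*t^2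
      + (19035648*y^4 - 1916928*y^6 + 65536*y^8 - 79361856*y^2 + 119574225) := by
    funext t; unfold g16; ring
  have h2 := ((((hasDerivAt_pow 8 x).const_mul 1048576).add
    ((hasDerivAt_pow 6 x).const_mul (7372800 + 2621440*y^2))).add
    ((hasDerivAt_pow 4 x).const_mul (-29673216 - 21012480*y^2 + 2162688*y^4))).add
    ((hasDerivAt_pow 2 x).const_mul
      (95178240*y^2 - 14376960*y^4 + 655360*y^6 - 198404640)) |>.add_const
      (19035648*y^4 - 1916928*y^6 + 65536*y^8 - 79361856*y^2 + 119574225)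
  rw [e]
  refine h2.deriv.trans ?_
  unfold gU
  push_cast
  ring

theorem deriv_y (x y : ℝ) :
    deriv (fun t : ℝ => g16 x t) y = 32 * y * gV (16*x^2) (16*y^2) := by
  have e : (fun t : ℝ => g16 x t) = fun t : ℝ =>
      65536*t^8 + (-1916928 + 655360*x^2)*t^6
      + (19035648 - 14376960*x^2 + 2162688*x^4)*t^4
      + (95178240*x^2 - 21012480*x^4 + 2621440*x^6 - 79361856)*t^2
      + (-29673216*x^4 + 7372800*x^6 + 1048576*x^8 + 119574225 - 198404640*x^2) := by
    funext t; unfold g16; ring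
  have h2 := ((((hasDerivAt_pow 8 y).const_mul 65536).add
    ((hasDerivAt_pow 6 y).const_mul (-1916928 + 655360*x^2))).add
    ((hasDerivAt_pow 4 y).const_mul (19035648 - 14376960*x^2 + 2162688*x^4))).add
    ((hasDerivAt_pow 2 y).const_mul
      (95178240*x^2 - 21012480*x^4 + 2621440*x^6 - 79361856)) |>.add_const
      (-29673216*x^4 + 7372800*x^6 + 1048576*x^8 + 119574225 - 198404640*x^2)
  rw [e]
  refine h2.deriv.trans ?_
  unfold gV
  push_cast
  ring

theorem ellipse_critical_two_singular_points :
    {q : ℝ × ℝ | g16 q.1 q.2 = 0 ∧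
        deriv (fun t : ℝ => g16 t q.2) q.1 = 0 ∧
        deriv (fun t : ℝ => g16 q.1 t) q.2 = 0}
      = {((0 : ℝ), (9/4 : ℝ)), ((0 : ℝ), (-9/4 : ℝ))} := by
  ext ⟨x, y⟩
  simp only [Set.mem_ofPred_eq, Set.mem_insert_iff, Set.mem_singleton_iff, Prod.mk.injEq,
    deriv_x, deriv_y]
  constructor
  · rintro ⟨h, hx, hy⟩
    rw [g16_eq] at h
    have hx0 : x = 0 := by
      by_contra hne
      have hxpos : 0 < x^2 := by positivity
      have hu : gU (16*x^2) (16*y^2) = 0 := by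
        rcases mul_eq_zero.1 hx with h' | h'
        · exact absurd h' (by simpa using hne)
        · exact h'
      rcases eq_or_ne y 0 with rfl | hyne
      · have hf : (16*x^2 - 81) * ((16*x^2 - 9) * (4*(16*x^2) + 405)^2) = 0 := by
          unfold gUV at h; linear_combination h
        have hp : (4*(16*x^2) + 405)^2 ≠ 0 := by positivity
        unfold gU at hu
        rcases mul_eq_zero.1 hf with h1 | h1
        · have : x^2 = 81/16 := by linarith
          rw [this] at hu; norm_num at hu
        · have : x^2 = 9/16 := by
            rcases mul_eq_zero.1 h1 with h2 | h2
            · linarith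
            · exact absurd h2 hp
          rw [this] at hu; norm_num at hu
      · have hv : gV (16*x^2) (16*y^2) = 0 := by
          rcases mul_eq_zero.1 hy with h' | h'
          · exact absurd h' (by simpa using hyne)
          · exact h'
        have := cert _ _ h hu hv
        have : 0 < 16*x^2 * ((16*x^2)^2 + 3888)^2 := by positivity
        linarith
    subst hx0
    have hf : (16*y^2 - 81)^3 * (16*y^2 - 225) = 0 := by
      unfold gUV at h; linear_combination h
    have hy2 : y^2 = 81/16 := by
      rcases mul_eq_zero.1 hf with h1 | h1
      · have := pow_eq_zero_iff (three_ne_zero) |>.1 h1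
        linarith
      · exfalso
        have h2 : y^2 = 225/16 := by linarith
        rcases mul_eq_zero.1 hy with h' | h'
        · have : y = 0 := by linarith
          rw [this] at h2; norm_num at h2
        · unfold gV at h'
          rw [h2] at h'; norm_num at h'
    have : (y - 9/4) * (y + 9/4) = 0 := by linear_combination hy2
    rcases mul_eq_zero.1 this with h1 | h1
    · left; exact ⟨rfl, by linarith⟩
    · right; exact ⟨rfl, by linarith⟩
  · rintro (⟨rfl, rfl⟩ | ⟨rfl, rfl⟩) <;> norm_num [g16, gV]
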